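/- Multistep Interleave: Assume step is closed under framing. If σ : Ω₁@T₁ ⟹ Ω₁'@T₁' and σ' : Ω₂@T₂ ⟹ Ω₂'@T₂' are timed multistep derivations, then there is a timed multistep derivation ⋈(σ,σ') : (Ω₁ ⊎ Ω₂)@min(T₁,T₂) ⟹ (Ω₁' ⊎ Ω₂')@max(T₁',T₂'). -/

import Mathlib

/-- Configurations: finite multisets of atomic objects. -/
abbrev Cfg (A : Type*) := Multiset A

/-- Timed multistep derivations `Ω@T ⟹ Ω'@T'` (proof-relevant). -/
inductive MultiStep {A : Type*} {FinTime : Type*} [LinearOrder FinTime]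
    (step : Cfg A → FinTime → Cfg A → Prop) :
    Cfg A → FinTime → Cfg A → FinTime → Type _ where
  | refl (Ω : Cfg A) (T : FinTime) : MultiStep step Ω T Ω T
  | stepT {Ω Ω' : Cfg A} {T₁ T₂ T₃ : FinTime} (h : T₁ ≤ T₂)
      (σ : MultiStep step Ω T₂ Ω' T₃) : MultiStep step Ω T₁ Ω' T₃
  | stepC {Ω Ω' Ω'' : Cfg A} {T₁ T₂ : FinTime} (h : step Ω T₁ Ω')
      (σ : MultiStep step Ω' T₁ Ω'' T₂) : MultiStep step Ω T₁ Ω'' T₂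

/-- Extend the final time of a derivation. -/
theorem MultiStep.extendEnd {A : Type*} {FinTime : Type*} [LinearOrder FinTime]
    {step : Cfg A → FinTime → Cfg A → Prop} {Ω Ω' : Cfg A} {T T' : FinTime}
    (σ : MultiStep step Ω T Ω' T') :
    ∀ U, T' ≤ U → Nonempty (MultiStep step Ω T Ω' U) := by
  induction σ with
  | refl Ω T => exact fun U h => ⟨.stepT h (.refl Ω U)⟩
  | stepT h _ ih => exact fun U hU => (ih U hU).map (.stepT h)
  | stepC h _ ih => exact fun U hU => (ih U hU).map (.stepC h)

/-- Frame a derivation on the right. -/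
theorem MultiStep.frame {A : Type*} {FinTime : Type*} [LinearOrder FinTime]
    {step : Cfg A → FinTime → Cfg A → Prop}
    (hframe : ∀ (Ω : Cfg A) (T : FinTime) (Ω' Ω₀ : Cfg A),
      step Ω T Ω' → step (Ω + Ω₀) T (Ω' + Ω₀))
    (Ω₀ : Cfg A) {Ω Ω' : Cfg A} {T T' : FinTime}
    (σ : MultiStep step Ω T Ω' T') :
    Nonempty (MultiStep step (Ω + Ω₀) T (Ω' + Ω₀) T') := by
  induction σ with
  | refl Ω T => exact ⟨.refl _ _⟩
  | stepT h _ ih => exact ih.map (.stepT h)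
  | stepC h _ ih => exact ih.map (.stepC (hframe _ _ _ _ h))

/-- **Multistep Interleave**: assuming `step` is closed under framing, given
`σ : Ω₁@T₁ ⟹ Ω₁'@T₁'` and `σ' : Ω₂@T₂ ⟹ Ω₂'@T₂'`, there is a timed multistep
derivation `(Ω₁ ⊎ Ω₂)@min(T₁,T₂) ⟹ (Ω₁' ⊎ Ω₂')@max(T₁',T₂')`. -/
theorem multistep_interleave {A : Type*} {FinTime : Type*} [LinearOrder FinTime]
    (step : Cfg A → FinTime → Cfg A → Prop)
    (hframe : ∀ (Ω : Cfg A) (T : FinTime) (Ω' Ω₀ : Cfg A),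
      step Ω T Ω' → step (Ω + Ω₀) T (Ω' + Ω₀))
    {Ω₁ Ω₁' Ω₂ Ω₂' : Cfg A} {T₁ T₁' T₂ T₂' : FinTime}
    (σ : MultiStep step Ω₁ T₁ Ω₁' T₁') (σ' : MultiStep step Ω₂ T₂ Ω₂' T₂') :
    Nonempty (MultiStep step (Ω₁ + Ω₂) (min T₁ T₂) (Ω₁' + Ω₂') (max T₁' T₂')) := by
  induction σ generalizing Ω₂ Ω₂' T₂ T₂' with
  | refl Ω T =>
    obtain ⟨τ⟩ := MultiStep.frame hframe Ω σ'
    obtain ⟨τ'⟩ := τ.extendEnd (max T T₂') (le_max_right _ _)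
    rw [add_comm Ω Ω₂, add_comm Ω Ω₂']
    exact ⟨.stepT (min_le_right _ _) τ'⟩
  | stepT h _ ih => exact (ih σ').map (.stepT (min_le_min_right _ h))
  | @stepC Ω Ωa Ωb T T' h σ₁ ih =>
    induction σ' with
    | refl Ω₀ T₀ =>
      obtain ⟨τ⟩ := MultiStep.frame hframe Ω₀ (MultiStep.stepC h σ₁)
      obtain ⟨τ'⟩ := τ.extendEnd (max T' T₀) (le_max_left _ _)
      exact ⟨.stepT (min_le_left _ _) τ'⟩
    | stepT h' _ ih' => exact ih'.map (.stepT (min_le_min_left _ h'))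
    | @stepC Δ Δa Δb S S' h' σ₂ ih' =>
      rcases le_total T S with hTS | hTS
      · have := ih (MultiStep.stepC h' σ₂)
        rw [min_eq_left hTS] at this ⊢
        exact this.map (.stepC (hframe _ _ _ _ h))
      · rw [min_eq_right hTS] at ih' ⊢
        refine ih'.map (.stepC ?_)
        rw [add_comm Ω Δ, add_comm Ω Δa]
        exact hframe _ _ _ _ h'
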